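/- Let φ ∈ Φ, let {K_w}_{w>0} satisfy condition (K_w.1) with absolute constant A > 0, and let f ∈ BV^φ(ℝ^N_+) lie in the domain of the operators T_w, with ζ > 0 a constant such that V^φ[ζ f] < +∞. Then for every λ with 0 < λ ≤ ζ/A and every w > 0 one has V^φ[λ(T_w f)] ≤ V^φ[ζ f]; in particular, for every w > 0, T_w maps BV^φ(ℝ^N_+) into BV^φ(ℝ^N_+). -/

import Mathlib

open MeasureTheory Filter Set Asymptotics
open scoped ENNReal

noncomputable section

/-- The class `Φ`: `φ : [0,∞) → [0,∞)` convex, vanishing exactly at `0`,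
with `φ(u)/u → 0` as `u → 0⁺`. -/
def IsPhiFun (φ : ℝ → ℝ) : Prop :=
  ConvexOn ℝ (Set.Ici 0) φ ∧ (∀ u, 0 ≤ u → 0 ≤ φ u) ∧
  (∀ u, 0 ≤ u → (φ u = 0 ↔ u = 0)) ∧
  Tendsto (fun u => φ u / u) (nhdsWithin 0 (Set.Ioi 0)) (nhds 0)

/-- The positive orthant `ℝ^N_+ = (0,∞)^N`. -/
def RPos (N : ℕ) : Set (Fin N → ℝ) := {x | ∀ i, 0 < x i}

/-- `⟨t⟩ := ∏ᵢ tᵢ`. -/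
def prodCoord {N : ℕ} (t : Fin N → ℝ) : ℝ := ∏ i, t i

/-- Euclidean distance `|1 - t|`. -/
def distOne {N : ℕ} (t : Fin N → ℝ) : ℝ := Real.sqrt (∑ i, (1 - t i) ^ 2)

/-- Euclidean norm `|log t|` of `log t := (log t₁, …, log t_N)`. -/
def logNorm {N : ℕ} (t : Fin N → ℝ) : ℝ := Real.sqrt (∑ i, Real.log (t i) ^ 2)

/-- `t^w := (t₁^w, …, t_N^w)`. -/
def powVec {N : ℕ} (t : Fin N → ℝ) (w : ℝ) : Fin N → ℝ := fun i => t i ^ w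

/-- The (Musielak–Orlicz) `φ`-variation of `g` on `[a,b]`:
`sup_D ∑ᵢ φ(|g(sᵢ) - g(sᵢ₋₁)|)` over all partitions `D` of `[a,b]`. -/
def phiVar1 (φ : ℝ → ℝ) (a b : ℝ) (g : ℝ → ℝ) : ℝ≥0∞ :=
  ⨆ (n : ℕ) (u : Fin (n + 1) → ℝ) (_ : Monotone u) (_ : u 0 = a) (_ : u (Fin.last n) = b),
    ∑ i : Fin n, ENNReal.ofReal (φ |g (u i.succ) - g (u i.castSucc)|)

/-- The point of `ℝ^N` obtained from `x'` (coordinates `≠ j`) by inserting `s`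
at the `j`-th coordinate. -/
def insertCoord {N : ℕ} (j : Fin N) (x' : {i : Fin N // i ≠ j} → ℝ) (s : ℝ) :
    Fin N → ℝ :=
  fun i => if h : i = j then s else x' ⟨i, h⟩

/-- `Φ^φ_j(f, I)`: the integral over `I'_j` (with weight `⟨x'_j⟩⁻¹`) of the `φ`-variations
of the `j`-th sections of `f`, where `I = ∏ᵢ [aᵢ, bᵢ]`. -/
def secVar {N : ℕ} (φ : ℝ → ℝ) (f : (Fin N → ℝ) → ℝ) (a b : Fin N → ℝ) (j : Fin N) :
    ℝ≥0∞ :=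
  ∫⁻ x' in Set.pi Set.univ (fun i : {i : Fin N // i ≠ j} => Set.Icc (a i.1) (b i.1)),
    phiVar1 φ (a j) (b j) (fun s => f (insertCoord j x' s)) *
      ENNReal.ofReal ((∏ i : {i : Fin N // i ≠ j}, x' i)⁻¹)

/-- `Φ^φ(f, I) := (∑_j Φ^φ_j(f,I)²)^{1/2}`. -/
def boxPhi {N : ℕ} (φ : ℝ → ℝ) (f : (Fin N → ℝ) → ℝ) (a b : Fin N → ℝ) : ℝ≥0∞ :=
  (∑ j : Fin N, secVar φ f a b j ^ 2) ^ ((1 : ℝ) / 2)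

/-- `{J_1, …, J_m}`, with `J_k = ∏ᵢ [c k i, d k i]`, is a partition of `I = ∏ᵢ [aᵢ, bᵢ]`
into non-overlapping `N`-dimensional intervals covering `I`. -/
def IsBoxPartition {N : ℕ} (a b : Fin N → ℝ) {m : ℕ} (c d : Fin m → Fin N → ℝ) : Prop :=
  (∀ k i, c k i ≤ d k i) ∧
  (⋃ k, Set.pi Set.univ fun i => Set.Icc (c k i) (d k i)) =
    Set.pi Set.univ (fun i => Set.Icc (a i) (b i)) ∧
  Pairwise fun k l =>
    Disjoint (Set.pi Set.univ fun i => Set.Ioo (c k i) (d k i))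
      (Set.pi Set.univ fun i => Set.Ioo (c l i) (d l i))

/-- The multidimensional (Tonelli-type) `φ`-variation `V^φ_I[f]` of `f` on
`I = ∏ᵢ [aᵢ, bᵢ]`: the sup of `∑ₖ Φ^φ(f, J_k)` over all partitions of `I` into
`N`-dimensional intervals. -/
def varOn {N : ℕ} (φ : ℝ → ℝ) (f : (Fin N → ℝ) → ℝ) (a b : Fin N → ℝ) : ℝ≥0∞ :=
  ⨆ (m : ℕ) (c : Fin m → Fin N → ℝ) (d : Fin m → Fin N → ℝ) (_ : IsBoxPartition a b c d),
    ∑ k, boxPhi φ f (c k) (d k)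

/-- `V^φ[f]`, the `φ`-variation of `f` over the whole `ℝ^N_+`: the sup of `V^φ_I[f]`
over all intervals `I ⊂ ℝ^N_+`. -/
def totalVar {N : ℕ} (φ : ℝ → ℝ) (f : (Fin N → ℝ) → ℝ) : ℝ≥0∞ :=
  ⨆ (a : Fin N → ℝ) (b : Fin N → ℝ) (_ : ∀ i, 0 < a i) (_ : ∀ i, a i ≤ b i),
    varOn φ f a b

/-- `f ∈ BV^φ(ℝ^N_+)`: `f` measurable with `V^φ[λ f] < ∞` for some `λ > 0`. -/
def MemBVphi {N : ℕ} (φ : ℝ → ℝ) (f : (Fin N → ℝ) → ℝ) : Prop :=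
  Measurable f ∧ ∃ l > (0 : ℝ), totalVar φ (fun x => l * f x) < ⊤

/-- The Mellin-type operator `(T f)(s) := ∫_{ℝ^N_+} K(t) f(st) ⟨t⟩⁻¹ dt`. -/
def mellinOp {N : ℕ} (K : (Fin N → ℝ) → ℝ) (f : (Fin N → ℝ) → ℝ) (s : Fin N → ℝ) : ℝ :=
  ∫ t in RPos N, K t * f (s * t) * (prodCoord t)⁻¹

/-- `f` belongs to the domain of the operators `T_w`: the defining integrals exist
finitely for every `s ∈ ℝ^N_+` and `w > 0`. -/
def InDomain {N : ℕ} (K : ℝ → (Fin N → ℝ) → ℝ) (f : (Fin N → ℝ) → ℝ) : Prop :=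
  ∀ w > (0 : ℝ), ∀ s ∈ RPos N,
    IntegrableOn (fun t => K w t * f (s * t) * (prodCoord t)⁻¹) (RPos N)

/-- Condition `(K_w.1)` with absolute constant `A`: each `K_w` is measurable and
integrable w.r.t. `⟨t⟩⁻¹ dt`, with `∫ |K_w| dμ ≤ A` and `∫ K_w dμ = 1`. -/
def KernelCond1 {N : ℕ} (K : ℝ → (Fin N → ℝ) → ℝ) (A : ℝ) : Prop :=
  ∀ w > (0 : ℝ), Measurable (K w) ∧
    IntegrableOn (fun t => K w t * (prodCoord t)⁻¹) (RPos N) ∧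
    (∫ t in RPos N, |K w t| * (prodCoord t)⁻¹) ≤ A ∧
    (∫ t in RPos N, K w t * (prodCoord t)⁻¹) = 1

/-- Condition `(K_w.2)`: for every `δ ∈ (0,1)`,
`∫_{|1-t|>δ} |K_w(t)| ⟨t⟩⁻¹ dt → 0` as `w → +∞`. -/
def KernelCond2 {N : ℕ} (K : ℝ → (Fin N → ℝ) → ℝ) : Prop :=
  ∀ δ : ℝ, 0 < δ → δ < 1 →
    Tendsto (fun w => ∫ t in {t ∈ RPos N | δ < distOne t}, |K w t| * (prodCoord t)⁻¹)
      atTop (nhds 0)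

/-- The `φ`-modulus of smoothness `ω^φ(f, δ) := sup_{|1-t| ≤ δ} V^φ[τ_t f - f]`. -/
def modSmooth {N : ℕ} (φ : ℝ → ℝ) (f : (Fin N → ℝ) → ℝ) (δ : ℝ) : ℝ≥0∞ :=
  ⨆ (t : Fin N → ℝ) (_ : t ∈ RPos N) (_ : distOne t ≤ δ),
    totalVar φ (fun s => f (s * t) - f s)

/-- `f` is locally `φ`-absolutely continuous on `ℝ^N_+` (uniformly, in the sense of
Tonelli) with constant `l`. -/
def LocACphiWith {N : ℕ} (φ : ℝ → ℝ) (f : (Fin N → ℝ) → ℝ) (l : ℝ) : Prop :=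
  ∀ a b : Fin N → ℝ, (∀ i, 0 < a i) → (∀ i, a i ≤ b i) → ∀ j : Fin N,
    ∀ ε > (0 : ℝ), ∃ δ > (0 : ℝ),
      ∀ᵐ x' ∂(volume.restrict
          (Set.pi Set.univ (fun i : {i : Fin N // i ≠ j} => Set.Icc (a i.1) (b i.1)))),
        ∀ n : ℕ, ∀ α β : Fin n → ℝ,
          (∀ i, a j ≤ α i ∧ α i ≤ β i ∧ β i ≤ b j) →
          (Pairwise fun i i' =>
            Disjoint (Set.Ioo (α i) (β i)) (Set.Ioo (α i') (β i'))) →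
          (∑ i, φ (β i - α i)) < δ →
          (∑ i, φ (l * |f (insertCoord j x' (β i)) - f (insertCoord j x' (α i))|)) < ε

/-- `f ∈ AC^φ(ℝ^N_+)`: `f` is measurable, of bounded `φ`-variation and locally
`φ`-absolutely continuous on `ℝ^N_+`. -/
def MemACphi {N : ℕ} (φ : ℝ → ℝ) (f : (Fin N → ℝ) → ℝ) : Prop :=
  MemBVphi φ f ∧ ∃ l > (0 : ℝ), LocACphiWith φ f l

/-- `{K_w}` is an `α`-singular kernel: for every `δ ∈ (0,1)`,
`∫_{|1-t|>δ} |K_w(t)| ⟨t⟩⁻¹ dt = O(w^{-α})` as `w → +∞`. -/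
def AlphaSingular {N : ℕ} (K : ℝ → (Fin N → ℝ) → ℝ) (α : ℝ) : Prop :=
  ∀ δ : ℝ, 0 < δ → δ < 1 →
    (fun w => ∫ t in {t ∈ RPos N | δ < distOne t}, |K w t| * (prodCoord t)⁻¹)
      =O[atTop] fun w : ℝ => w ^ (-α)

/-- The Lipschitz class `V^φ Lip_N(α)`: `f ∈ BV^φ(ℝ^N_+)` such that, for some `μ > 0`,
`V^φ[μ(τ_t f - f)] = O(|log t|^α)` as `|1 - t| → 0`. -/
def MemLipAlpha {N : ℕ} (φ : ℝ → ℝ) (α : ℝ) (f : (Fin N → ℝ) → ℝ) : Prop :=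
  MemBVphi φ f ∧ ∃ μ > (0 : ℝ), ∃ C > (0 : ℝ), ∃ η > (0 : ℝ),
    ∀ t ∈ RPos N, distOne t ≤ η →
      totalVar φ (fun x => μ * (f (x * t) - f x)) ≤ ENNReal.ofReal (C * logNorm t ^ α)

/-- An open neighbourhood of `∏ᵢ {0, …, nᵢ}` in Baire space contains all sequences whose first
`k` terms are bounded by those of `n`, for some `k`. -/
theorem exists_setOf_forall_lt_le_subset_of_isOpen {W : Set (ℕ → ℕ)} (hW : IsOpen W) {n : ℕ → ℕ}
    (h : {x : ℕ → ℕ | ∀ i, x i ≤ n i} ⊆ W) :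
    ∃ k, {x : ℕ → ℕ | ∀ i < k, x i ≤ n i} ⊆ W := by
  by_contra! hcon
  simp only [not_subset, mem_ofPred_eq] at hcon
  choose x hx hxW using hcon
  have hK : IsCompact {x : ℕ → ℕ | ∀ i, x i ≤ n i} := by
    have : {x : ℕ → ℕ | ∀ i, x i ≤ n i} = Icc 0 n := by
      ext; simp [Pi.le_def]
    exact this ▸ isCompact_Icc
  obtain ⟨y, hy, g, hg, hlim⟩ := hK.tendsto_subseq (x := fun k i => min (x k i) (n i))
    (fun k i => min_le_right _ _)
  have hlim' : Tendsto (x ∘ g) atTop (nhds y) := by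
    rw [tendsto_pi_nhds] at hlim ⊢
    intro i
    refine (hlim i).congr' ?_
    filter_upwards [eventually_gt_atTop i] with k hk
    exact min_eq_left (hx (g k) i (hk.trans_le (hg.le_apply)))
  obtain ⟨k, hk⟩ := (hlim'.eventually (hW.mem_nhds (h hy))).exists
  exact hxW (g k) hk

/-- Analytic sets are inner regular with respect to compact sets, for finite measures. -/
theorem MeasureTheory.AnalyticSet.exists_isCompact_lt_measure {α : Type*} [TopologicalSpace α]
    [MeasurableSpace α] {μ : Measure α} [μ.OuterRegular] {s : Set α} (hs : AnalyticSet s)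
    {c : ℝ≥0∞} (hc : c < μ s) : ∃ K ⊆ s, IsCompact K ∧ c ≤ μ K := by
  rw [AnalyticSet] at hs
  rcases hs with rfl | ⟨f, hf, rfl⟩
  · simp at hc
  have step : ∀ S : {S : Set (ℕ → ℕ) // c < μ (f '' S)}, ∀ k, ∃ m : ℕ,
      c < μ (f '' (S.1 ∩ {x | x k ≤ m})) := by
    intro S k
    have hmono : Monotone fun m : ℕ => f '' (S.1 ∩ {x | x k ≤ m}) := fun m m' h =>
      image_mono (inter_subset_inter_right _ fun x (hx : x k ≤ m) => hx.trans h)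
    have hU : ⋃ m : ℕ, f '' (S.1 ∩ {x | x k ≤ m}) = f '' S.1 := by
      rw [← image_iUnion, ← inter_iUnion]
      congr 1
      exact inter_eq_left.2 fun x _ => mem_iUnion.2 ⟨x k, le_refl (x k)⟩
    have hS := S.2
    rw [← hU, hmono.measure_iUnion] at hS
    exact lt_iSup_iff.1 hS
  choose m hm using step
  let S : ℕ → {S : Set (ℕ → ℕ) // c < μ (f '' S)} := fun k =>
    Nat.rec ⟨univ, by rwa [image_univ]⟩ (fun k S => ⟨S.1 ∩ {x | x k ≤ m S k}, hm S k⟩) k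
  have hS : ∀ k, (S k).1 = {x | ∀ i < k, x i ≤ m (S i) i} := by
    intro k
    induction k with
    | zero => ext; simp [S]
    | succ k ih =>
      have : (S (k + 1)).1 = (S k).1 ∩ {x | x k ≤ m (S k) k} := rfl
      rw [this, ih]
      ext x
      simp only [mem_inter_iff, mem_ofPred_eq, Nat.lt_succ_iff_lt_or_eq, or_imp, forall_and,
        forall_eq]
  have hK : IsCompact {x : ℕ → ℕ | ∀ i, x i ≤ m (S i) i} := by
    have : {x : ℕ → ℕ | ∀ i, x i ≤ m (S i) i} = Icc 0 fun i => m (S i) i := by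
      ext; simp [Pi.le_def]
    exact this ▸ isCompact_Icc
  refine ⟨_, image_subset_range f _, hK.image hf, ?_⟩
  by_contra! hlt
  obtain ⟨U, hU, hUo, hUc⟩ := exists_isOpen_lt_of_lt _ _ hlt
  obtain ⟨k, hk⟩ := exists_setOf_forall_lt_le_subset_of_isOpen (hUo.preimage hf)
    (image_subset_iff.1 hU)
  rw [← hS] at hk
  exact ((S k).2.trans_le (measure_mono (image_subset_iff.2 hk))).not_ge hUc.le

/-- Analytic sets in a Polish space are null measurable for every s-finite Borel measure. -/
theorem MeasureTheory.AnalyticSet.nullMeasurableSet {α : Type*} [TopologicalSpace α] [PolishSpace α]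
    [MeasurableSpace α] [BorelSpace α] {s : Set α} (hs : AnalyticSet s) (μ : Measure α)
    [SFinite μ] : NullMeasurableSet s μ := by
  let := TopologicalSpace.upgradeIsCompletelyMetrizable α
  obtain ⟨ν, hν, hμν, -⟩ := exists_isFiniteMeasure_absolutelyContinuous μ
  refine NullMeasurableSet.mono_ac ?_ hμν
  rcases eq_or_ne (ν s) 0 with h0 | h0
  · exact .of_null h0
  obtain ⟨u, -, hu, hlim⟩ := exists_seq_strictMono_tendsto' (pos_iff_ne_zero.2 h0)
  choose K hKs hK hKu using fun n => hs.exists_isCompact_lt_measure (hu n).2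
  have hB : MeasurableSet (⋃ n, K n) := .iUnion fun n => (hK n).measurableSet
  refine hB.nullMeasurableSet.congr (ae_eq_of_subset_of_measure_ge (iUnion_subset hKs) ?_
    hB.nullMeasurableSet (measure_ne_top _ _))
  exact le_of_tendsto' hlim fun n => (hKu n).trans (measure_mono (subset_iUnion K n))

theorem phiVar1_le_iff {φ : ℝ → ℝ} {a b : ℝ} {g : ℝ → ℝ} {C : ℝ≥0∞} :
    phiVar1 φ a b g ≤ C ↔ ∀ (n : ℕ) (u : Fin (n + 1) → ℝ), Monotone u → u 0 = a →
      u (Fin.last n) = b → ∑ i : Fin n, ENNReal.ofReal (φ |g (u i.succ) - g (u i.castSucc)|) ≤ C := by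
  simp only [phiVar1, iSup_le_iff]

theorem sum_le_phiVar1 (φ : ℝ → ℝ) {a b : ℝ} (g : ℝ → ℝ) {n : ℕ} {u : Fin (n + 1) → ℝ}
    (hu : Monotone u) (ha : u 0 = a) (hb : u (Fin.last n) = b) :
    ∑ i : Fin n, ENNReal.ofReal (φ |g (u i.succ) - g (u i.castSucc)|) ≤ phiVar1 φ a b g :=
  phiVar1_le_iff.1 le_rfl n u hu ha hb

/-- The `φ`-variation of a jointly measurable family of functions is almost everywhere measurable
in the parameter: its superlevel sets are analytic. -/
theorem aemeasurable_phiVar1 {X : Type*} [TopologicalSpace X] [PolishSpace X] [MeasurableSpace X]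
    [BorelSpace X] {φ : ℝ → ℝ} (hφ : Measurable fun x => φ |x|) {g : X → ℝ → ℝ}
    (hg : Measurable (Function.uncurry g)) (a b : ℝ) (μ : Measure X) [SFinite μ] :
    AEMeasurable (fun x => phiVar1 φ a b (g x)) μ := by
  refine NullMeasurable.aemeasurable ?_
  have key : ∀ c, NullMeasurableSet ((fun x => phiVar1 φ a b (g x)) ⁻¹' Ioi c) μ := by
    intro c
    have hset : (fun x => phiVar1 φ a b (g x)) ⁻¹' Ioi c = ⋃ n : ℕ, Prod.fst ''
        {p : X × (Fin (n + 1) → ℝ) | Monotone p.2 ∧ p.2 0 = a ∧ p.2 (Fin.last n) = b ∧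
          c < ∑ i : Fin n,
            ENNReal.ofReal (φ |g p.1 (p.2 i.succ) - g p.1 (p.2 i.castSucc)|)} := by
      ext x
      simp only [phiVar1, mem_preimage, mem_Ioi, lt_iSup_iff, mem_iUnion, mem_image, mem_ofPred_eq,
        exists_prop]
      constructor
      · rintro ⟨n, u, hu, ha, hb, hc⟩
        exact ⟨n, (x, u), ⟨hu, ha, hb, hc⟩, rfl⟩
      · rintro ⟨n, ⟨_, u⟩, ⟨hu, ha, hb, hc⟩, rfl⟩
        exact ⟨n, u, hu, ha, hb, hc⟩
    rw [hset]
    refine .iUnion fun n => (MeasurableSet.analyticSet ?_).image_of_continuous continuous_fst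
      |>.nullMeasurableSet μ
    have hgi : ∀ i : Fin (n + 1),
        Measurable fun p : X × (Fin (n + 1) → ℝ) => g p.1 (p.2 i) := fun i =>
      hg.comp (measurable_fst.prodMk ((measurable_pi_apply i).comp measurable_snd))
    have hsum : Measurable fun p : X × (Fin (n + 1) → ℝ) => ∑ i : Fin n,
        ENNReal.ofReal (φ |g p.1 (p.2 i.succ) - g p.1 (p.2 i.castSucc)|) :=
      Finset.measurable_sum _ fun i _ =>
        ENNReal.measurable_ofReal.comp (hφ.comp ((hgi _).sub (hgi _)))
    exact (isClosed_monotone.preimage continuous_snd).measurableSet.inter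
      ((measurableSet_eq_fun (by fun_prop) measurable_const).inter
        ((measurableSet_eq_fun (by fun_prop) measurable_const).inter
          (measurableSet_lt measurable_const hsum)))
  exact @measurable_of_Ioi _ (NullMeasurableSpace X μ) _ _ _ _ _ _ _ _ key

theorem sum_lintegral_le_lintegral_sum {X ι : Type*} [MeasurableSpace X] (μ : Measure X)
    (s : Finset ι) (f : ι → X → ℝ≥0∞) :
    ∑ i ∈ s, ∫⁻ x, f i x ∂μ ≤ ∫⁻ x, ∑ i ∈ s, f i x ∂μ := by
  classical
  induction s using Finset.induction_on with
  | empty => simp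
  | insert i s hi ih =>
    simp only [Finset.sum_insert hi]
    exact (add_le_add_right ih _).trans (le_lintegral_add _ _)

/-- If the increments of `g` satisfy a Jensen-type inequality with respect to a family `G`, so does
the `φ`-variation. -/
theorem phiVar1_le_lintegral {X : Type*} [MeasurableSpace X] {μ : Measure X} {φ : ℝ → ℝ} {a b : ℝ}
    {g : ℝ → ℝ} {G : X → ℝ → ℝ}
    (h : ∀ s ∈ Icc a b, ∀ s' ∈ Icc a b,
      ENNReal.ofReal (φ |g s - g s'|) ≤ ∫⁻ x, ENNReal.ofReal (φ |G x s - G x s'|) ∂μ) :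
    phiVar1 φ a b g ≤ ∫⁻ x, phiVar1 φ a b (G x) ∂μ := by
  refine phiVar1_le_iff.2 fun n u hu ha hb => ?_
  have hmem : ∀ i, u i ∈ Icc a b := fun i =>
    ⟨ha ▸ hu (Fin.zero_le i), hb ▸ hu (Fin.le_last i)⟩
  calc _ ≤ ∑ i : Fin n, ∫⁻ x,
          ENNReal.ofReal (φ |G x (u i.succ) - G x (u i.castSucc)|) ∂μ :=
        Finset.sum_le_sum fun i _ => h _ (hmem _) _ (hmem _)
    _ ≤ _ := sum_lintegral_le_lintegral_sum _ _ _
    _ ≤ _ := lintegral_mono fun x => sum_le_phiVar1 φ (G x) hu ha hb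

theorem phiVar1_comp_mul_right_le (φ : ℝ → ℝ) (a b : ℝ) (g : ℝ → ℝ) {r : ℝ} (hr : 0 ≤ r) :
    phiVar1 φ a b (fun s => g (s * r)) ≤ phiVar1 φ (a * r) (b * r) g := by
  refine phiVar1_le_iff.2 fun n u hu ha hb => ?_
  exact sum_le_phiVar1 φ g (u := fun i => u i * r)
    (fun i k h => mul_le_mul_of_nonneg_right (hu h) hr) (by simp [ha]) (by simp [hb])

theorem measurable_insertCoord {N : ℕ} (j : Fin N) :
    Measurable fun p : ({i : Fin N // i ≠ j} → ℝ) × ℝ => insertCoord j p.1 p.2 := by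
  refine measurable_pi_lambda _ fun i => ?_
  by_cases h : i = j
  · simpa [insertCoord, h] using measurable_snd
  · simp only [insertCoord, h, dif_neg, not_false_eq_true]
    exact (measurable_pi_apply _).comp measurable_fst

theorem insertCoord_mul {N : ℕ} (j : Fin N) (x : {i : Fin N // i ≠ j} → ℝ) (s : ℝ)
    (t : Fin N → ℝ) :
    insertCoord j x s * t = insertCoord j (x * fun i => t i.1) (s * t j) := by
  ext i
  by_cases h : i = j
  · subst h; simp [insertCoord]
  · simp [insertCoord, h]

theorem preimage_mul_right_pi_Icc {ι : Type*} {r : ι → ℝ} (hr : ∀ i, 0 < r i) (a b : ι → ℝ) :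
    (fun x => x * r) ⁻¹' (Set.pi univ fun i => Icc (a i * r i) (b i * r i)) =
      Set.pi univ fun i => Icc (a i) (b i) := by
  ext x
  simp [-pi_univ_Icc, hr]

theorem preimage_mul_right_pi_Ioo {ι : Type*} {r : ι → ℝ} (hr : ∀ i, 0 < r i) (a b : ι → ℝ) :
    (fun x => x * r) ⁻¹' (Set.pi univ fun i => Ioo (a i * r i) (b i * r i)) =
      Set.pi univ fun i => Ioo (a i) (b i) := by
  ext x
  simp [hr]

/-- Invariance of the measure `⟨x⟩⁻¹ dx` under coordinatewise dilations. -/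
theorem setLIntegral_pi_Icc_mul_right {ι : Type*} [Fintype ι] {r : ι → ℝ} (hr : ∀ i, 0 < r i)
    (a b : ι → ℝ) (G : (ι → ℝ) → ℝ≥0∞) :
    ∫⁻ y in Set.pi univ fun i => Icc (a i * r i) (b i * r i), G y * ENNReal.ofReal (∏ i, y i)⁻¹ =
      ∫⁻ x in Set.pi univ fun i => Icc (a i) (b i), G (x * r) * ENNReal.ofReal (∏ i, x i)⁻¹ := by
  classical
  have hprod : 0 < ∏ i, r i := Finset.prod_pos fun i _ => hr i
  have hvol : (volume : Measure (ι → ℝ)) =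
      ENNReal.ofReal (∏ i, r i) • Measure.map (fun x => x * r) volume := by
    have h := Real.smul_map_diagonal_volume_pi (D := r)
      (by rw [Matrix.det_diagonal]; exact hprod.ne')
    rw [Matrix.det_diagonal, abs_of_pos hprod] at h
    have hfun : ⇑(Matrix.toLin' (Matrix.diagonal r)) = fun x => x * r := by
      ext x i
      simp [Matrix.mulVec_diagonal, mul_comm]
    rw [← hfun, h]
  have he : MeasurableEmbedding fun x : ι → ℝ => x * r :=
    (MeasurableEquiv.piCongrRight fun i =>
      MeasurableEquiv.mulRight₀ (r i) (hr i).ne').measurableEmbedding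
  conv_lhs => rw [hvol]
  rw [Measure.restrict_smul, lintegral_smul_measure, he.restrict_map, he.lintegral_map,
    preimage_mul_right_pi_Icc hr, smul_eq_mul, ← lintegral_const_mul' _ _ ENNReal.ofReal_ne_top]
  refine lintegral_congr fun x => ?_
  rw [mul_left_comm, ← ENNReal.ofReal_mul hprod.le]
  congr 2
  simp only [Pi.mul_apply, Finset.prod_mul_distrib]
  field_simp

theorem IsBoxPartition.mul_right {N m : ℕ} {a b : Fin N → ℝ} {c d : Fin m → Fin N → ℝ}
    (h : IsBoxPartition a b c d) {t : Fin N → ℝ} (ht : t ∈ RPos N) :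
    IsBoxPartition (a * t) (b * t) (fun k => c k * t) (fun k => d k * t) := by
  obtain ⟨h1, h2, h3⟩ := h
  have hsurj : Function.Surjective fun x : Fin N → ℝ => x * t := fun y =>
    ⟨y / t, by ext i; simp [(ht i).ne']⟩
  refine ⟨fun k i => mul_le_mul_of_nonneg_right (h1 k i) (ht i).le, ?_, fun k l hkl => ?_⟩
  · apply hsurj.preimage_injective
    simpa only [preimage_iUnion, Pi.mul_apply, preimage_mul_right_pi_Icc ht] using h2
  · refine Disjoint.of_preimage hsurj ?_
    simpa only [Pi.mul_apply, preimage_mul_right_pi_Ioo ht] using h3 hkl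

/-- Minkowski's integral inequality for the Euclidean norm, for lower integrals. -/
theorem rpow_sum_lintegral_sq_le {X ι : Type*} [MeasurableSpace X] (μ : Measure X) (s : Finset ι)
    (g : ι → X → ℝ≥0∞) :
    (∑ j ∈ s, (∫⁻ x, g j x ∂μ) ^ 2) ^ ((1 : ℝ) / 2) ≤
      ∫⁻ x, (∑ j ∈ s, g j x ^ 2) ^ ((1 : ℝ) / 2) ∂μ := by
  set I : ι → ℝ≥0∞ := fun j => ∫⁻ x, g j x ∂μ with hI
  set R := (∑ j ∈ s, I j ^ 2) ^ ((1 : ℝ) / 2) with hR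
  by_cases htop : ∃ j ∈ s, I j = ⊤
  · obtain ⟨j, hj, hjt⟩ := htop
    refine le_top.trans ?_
    rw [← hjt]
    refine lintegral_mono fun x => ?_
    calc g j x = (g j x ^ 2) ^ ((1 : ℝ) / 2) := by
          rw [← ENNReal.rpow_natCast, ← ENNReal.rpow_mul]; norm_num
      _ ≤ _ := ENNReal.rpow_le_rpow
          (Finset.single_le_sum (f := fun j => g j x ^ 2) (fun _ _ => zero_le) hj) (by norm_num)
  push Not at htop
  have hsq : R * R = ∑ j ∈ s, I j ^ 2 := by
    rw [hR, ← ENNReal.rpow_add_of_nonneg _ _ (by norm_num) (by norm_num)]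
    norm_num
  have hRtop : R ≠ ⊤ := ENNReal.rpow_ne_top_of_nonneg (by norm_num)
    (ENNReal.sum_ne_top.2 fun j hj => ENNReal.pow_ne_top (htop j hj))
  rcases eq_or_ne R 0 with h0 | h0
  · rw [h0]; exact zero_le
  refine (ENNReal.mul_le_mul_iff_right h0 hRtop).1 ?_
  calc R * R = ∑ j ∈ s, ∫⁻ x, I j * g j x ∂μ := by
        rw [hsq]
        refine Finset.sum_congr rfl fun j hj => ?_
        rw [lintegral_const_mul' _ _ (htop j hj), sq]
    _ ≤ ∫⁻ x, ∑ j ∈ s, I j * g j x ∂μ := sum_lintegral_le_lintegral_sum _ _ _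
    _ ≤ ∫⁻ x, R * (∑ j ∈ s, g j x ^ 2) ^ ((1 : ℝ) / 2) ∂μ := by
        refine lintegral_mono fun x => ?_
        simpa [hR] using ENNReal.inner_le_Lp_mul_Lq s I (g · x) Real.HolderConjugate.two_two
    _ = _ := lintegral_const_mul' _ _ hRtop

theorem IsPhiFun.zero {φ : ℝ → ℝ} (hφ : IsPhiFun φ) : φ 0 = 0 :=
  (hφ.2.2.1 0 le_rfl).2 rfl

theorem IsPhiFun.monotoneOn {φ : ℝ → ℝ} (hφ : IsPhiFun φ) : MonotoneOn φ (Ici 0) := by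
  intro x hx y hy hxy
  rw [mem_Ici] at hx hy
  rcases hy.eq_or_lt with rfl | hy0
  · rw [le_antisymm hxy hx]
  have h := hφ.1.2 (mem_Ici.2 hy) (mem_Ici.2 le_rfl) (div_nonneg hx hy)
    (sub_nonneg.2 ((div_le_one hy0).2 hxy)) (add_sub_cancel _ _)
  simp only [smul_eq_mul, mul_zero, add_zero, hφ.zero, div_mul_cancel₀ _ hy0.ne'] at h
  exact h.trans (mul_le_of_le_one_left (hφ.2.1 y hy) ((div_le_one hy0).2 hxy))

theorem IsPhiFun.convexOn_comp_abs {φ : ℝ → ℝ} (hφ : IsPhiFun φ) :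
    ConvexOn ℝ univ fun x => φ |x| := by
  refine ⟨convex_univ, fun x _ y _ a b ha hb hab => ?_⟩
  refine (hφ.monotoneOn (mem_Ici.2 (abs_nonneg _)) ?_ ?_).trans
    (hφ.1.2 (abs_nonneg x) (abs_nonneg y) ha hb hab)
  · exact add_nonneg (mul_nonneg ha (abs_nonneg x)) (mul_nonneg hb (abs_nonneg y))
  · refine (abs_add_le _ _).trans ?_
    simp [abs_mul, abs_of_nonneg ha, abs_of_nonneg hb]

theorem IsPhiFun.continuous_comp_abs {φ : ℝ → ℝ} (hφ : IsPhiFun φ) :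
    Continuous fun x => φ |x| :=
  continuousOn_univ.1 (hφ.convexOn_comp_abs.continuousOn isOpen_univ)

/-- Jensen's inequality for a nonnegative convex function, without integrability of the
composition. -/
theorem ofReal_map_integral_le_lintegral {X : Type*} [MeasurableSpace X] {P : Measure X}
    [IsProbabilityMeasure P] {ψ : ℝ → ℝ} (hψ : ConvexOn ℝ univ ψ) (h0 : ∀ x, 0 ≤ ψ x)
    {F : X → ℝ} (hF : Integrable F P) :
    ENNReal.ofReal (ψ (∫ x, F x ∂P)) ≤ ∫⁻ x, ENNReal.ofReal (ψ (F x)) ∂P := by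
  have hc : Continuous ψ := continuousOn_univ.1 (hψ.continuousOn isOpen_univ)
  by_cases hi : Integrable (fun x => ψ (F x)) P
  · rw [← ofReal_integral_eq_lintegral_ofReal hi (ae_of_all _ fun x => h0 _)]
    exact ENNReal.ofReal_le_ofReal (hψ.map_integral_le hc.continuousOn isClosed_univ
      (ae_of_all _ fun _ => mem_univ _) hF hi)
  · have htop : ∫⁻ x, ENNReal.ofReal (ψ (F x)) ∂P = ⊤ := by
      by_contra hne
      refine hi ⟨hc.comp_aestronglyMeasurable hF.1, ?_⟩
      rw [hasFiniteIntegral_iff_ofReal (ae_of_all _ fun x => h0 _)]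
      exact lt_top_iff_ne_top.2 hne
    rw [htop]
    exact le_top

theorem measurableSet_rPos (N : ℕ) : MeasurableSet (RPos N) := by
  have : RPos N = ⋂ i, {x | 0 < x i} := by
    ext; simp [RPos]
  rw [this]
  exact .iInter fun i => measurableSet_lt measurable_const (measurable_pi_apply i)

theorem measurable_prodCoord {N : ℕ} : Measurable (prodCoord (N := N)) :=
  Finset.measurable_prod _ fun i _ => measurable_pi_apply i

theorem prodCoord_pos {N : ℕ} {t : Fin N → ℝ} (ht : t ∈ RPos N) : 0 < prodCoord t :=
  Finset.prod_pos fun i _ => ht i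

/-- Integration against a Mellin kernel `k` is integration of a multiplier bounded by the mass of
`k` against the probability measure proportional to `|k(t)| ⟨t⟩⁻¹ dt`. -/
theorem exists_isProbabilityMeasure_mellin {N : ℕ} {k : (Fin N → ℝ) → ℝ} {A : ℝ}
    (hk : Measurable k) (hint : IntegrableOn (fun t => k t * (prodCoord t)⁻¹) (RPos N))
    (hA : ∫ t in RPos N, |k t| * (prodCoord t)⁻¹ ≤ A)
    (h1 : ∫ t in RPos N, k t * (prodCoord t)⁻¹ = 1) :
    ∃ P : Measure (Fin N → ℝ), IsProbabilityMeasure P ∧ (∀ᵐ t ∂P, t ∈ RPos N) ∧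
      ∃ σ : (Fin N → ℝ) → ℝ, (∀ t, |σ t| ≤ A) ∧ ∀ h : (Fin N → ℝ) → ℝ,
        IntegrableOn (fun t => k t * h t * (prodCoord t)⁻¹) (RPos N) →
          Integrable (fun t => σ t * h t) P ∧
          ∫ t in RPos N, k t * h t * (prodCoord t)⁻¹ = ∫ t, σ t * h t ∂P := by
  set M := ∫ t in RPos N, |k t| * (prodCoord t)⁻¹ with hM
  have habs : ∀ t ∈ RPos N, |k t * (prodCoord t)⁻¹| = |k t| * (prodCoord t)⁻¹ := fun t ht => by
    rw [abs_mul, abs_of_pos (inv_pos.2 (prodCoord_pos ht))]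
  have hM1 : 1 ≤ M := by
    calc (1 : ℝ) = |∫ t in RPos N, k t * (prodCoord t)⁻¹| := by rw [h1, abs_one]
      _ ≤ ∫ t in RPos N, |k t * (prodCoord t)⁻¹| := abs_integral_le_integral_abs
      _ = M := setIntegral_congr_fun (measurableSet_rPos N) habs
  have hM0 : 0 < M := one_pos.trans_le hM1
  have hint' : IntegrableOn (fun t => |k t| * (prodCoord t)⁻¹) (RPos N) :=
    IntegrableOn.congr_fun hint.abs habs (measurableSet_rPos N)
  let ρ : (Fin N → ℝ) → NNReal := fun t => Real.toNNReal (|k t| * (prodCoord t)⁻¹ / M)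
  have hρ : Measurable ρ := by
    have := measurable_prodCoord (N := N)
    fun_prop
  have hρmul : ∀ h : (Fin N → ℝ) → ℝ, ∀ t ∈ RPos N,
      k t * h t * (prodCoord t)⁻¹ = ρ t • ((SignType.sign (k t) : ℝ) * M * h t) := fun h t ht => by
    have hp := inv_pos.2 (prodCoord_pos ht)
    rw [NNReal.smul_def, Real.coe_toNNReal _ (by positivity), smul_eq_mul]
    conv_lhs => rw [← sign_mul_abs (k t)]
    field_simp
  refine ⟨(volume.restrict (RPos N)).withDensity fun t => (ρ t : ℝ≥0∞), ⟨?_⟩, ?_,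
    fun t => (SignType.sign (k t) : ℝ) * M, fun t => ?_, fun h hh => ⟨?_, ?_⟩⟩
  · rw [withDensity_apply _ MeasurableSet.univ, Measure.restrict_univ]
    change ∫⁻ t in RPos N, ENNReal.ofReal (|k t| * (prodCoord t)⁻¹ / M) = 1
    rw [← ofReal_integral_eq_lintegral_ofReal (hint'.div_const M), integral_div, ← hM,
      div_self hM0.ne', ENNReal.ofReal_one]
    filter_upwards [ae_restrict_mem (measurableSet_rPos N)] with t ht
    have hp := inv_pos.2 (prodCoord_pos ht)
    change 0 ≤ _
    positivity
  · exact (withDensity_absolutelyContinuous _ _).ae_le (ae_restrict_mem (measurableSet_rPos N))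
  · refine le_trans ?_ hA
    rw [abs_mul, abs_of_pos hM0]
    refine mul_le_of_le_one_left hM0.le ?_
    rcases lt_trichotomy (k t) 0 with h | h | h <;> simp [h]
  · rw [integrable_withDensity_iff_integrable_smul hρ]
    exact IntegrableOn.congr_fun hh (hρmul h) (measurableSet_rPos N)
  · rw [integral_withDensity_eq_integral_smul hρ]
    exact setIntegral_congr_fun (measurableSet_rPos N) (hρmul h)

theorem insertCoord_mem_rPos {N : ℕ} {j : Fin N} {x : {i : Fin N // i ≠ j} → ℝ} {s : ℝ}
    (hx : ∀ i, 0 < x i) (hs : 0 < s) : insertCoord j x s ∈ RPos N := by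
  intro i
  by_cases h : i = j
  · simpa [insertCoord, h] using hs
  · simpa [insertCoord, h] using hx ⟨i, h⟩

theorem lintegral_phiVar1_comp_mul_le_secVar {N : ℕ} (φ : ℝ → ℝ) (F : (Fin N → ℝ) → ℝ)
    (a b : Fin N → ℝ) (j : Fin N) {t : Fin N → ℝ} (ht : t ∈ RPos N) :
    ∫⁻ x in Set.pi univ (fun i : {i : Fin N // i ≠ j} => Icc (a i.1) (b i.1)),
      phiVar1 φ (a j) (b j) (fun s => F (insertCoord j x s * t)) *
        ENNReal.ofReal ((∏ i, x i)⁻¹) ≤ secVar φ F (a * t) (b * t) j := by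
  have hle : ∀ x : {i : Fin N // i ≠ j} → ℝ,
      phiVar1 φ (a j) (b j) (fun s => F (insertCoord j x s * t)) ≤
        phiVar1 φ (a j * t j) (b j * t j)
          fun s => F (insertCoord j (x * fun i => t i.1) s) := fun x => by
    have hj : 0 ≤ t j := (ht j).le
    have h := phiVar1_comp_mul_right_le φ (a j) (b j)
      (fun s => F (insertCoord j (x * fun i => t i.1) s)) hj
    simp only [insertCoord_mul]
    exact h
  have hscale := setLIntegral_pi_Icc_mul_right (r := fun i : {i : Fin N // i ≠ j} => t i.1)
    (fun i => ht i.1) (fun i => a i.1) (fun i => b i.1)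
    (fun y => phiVar1 φ (a j * t j) (b j * t j) fun s => F (insertCoord j y s))
  exact (lintegral_mono fun x => mul_le_mul_left (hle x) _).trans hscale.ge

/-- If the increments of `g` on the positive orthant are dominated by averages of the increments
of the dilates of `F`, then so are the section variations. -/
theorem secVar_le_lintegral {N : ℕ} {φ : ℝ → ℝ} (hφ : Measurable fun x => φ |x|)
    {g F : (Fin N → ℝ) → ℝ} (hF : Measurable F) {P : Measure (Fin N → ℝ)} [SFinite P]
    (hP : ∀ᵐ t ∂P, t ∈ RPos N)
    (h : ∀ s ∈ RPos N, ∀ s' ∈ RPos N, ENNReal.ofReal (φ |g s - g s'|) ≤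
      ∫⁻ t, ENNReal.ofReal (φ |F (s * t) - F (s' * t)|) ∂P)
    {a b : Fin N → ℝ} (ha : a ∈ RPos N) (j : Fin N) :
    secVar φ g a b j ≤ ∫⁻ t, secVar φ F (a * t) (b * t) j ∂P := by
  set B := Set.pi univ fun i : {i : Fin N // i ≠ j} => Icc (a i.1) (b i.1)
  have hB : MeasurableSet B := .univ_pi fun i => measurableSet_Icc
  calc secVar φ g a b j
      ≤ ∫⁻ x in B, (∫⁻ t, phiVar1 φ (a j) (b j) (fun s => F (insertCoord j x s * t)) ∂P) *
          ENNReal.ofReal ((∏ i, x i)⁻¹) := by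
        refine setLIntegral_mono' hB fun x hx => mul_le_mul_left ?_ _
        have hx0 : ∀ i, 0 < x i := fun i => (ha i.1).trans_le (hx i (mem_univ i)).1
        exact phiVar1_le_lintegral fun s hs s' hs' =>
          h _ (insertCoord_mem_rPos hx0 ((ha j).trans_le hs.1))
            _ (insertCoord_mem_rPos hx0 ((ha j).trans_le hs'.1))
    _ = ∫⁻ x in B, ∫⁻ t, phiVar1 φ (a j) (b j) (fun s => F (insertCoord j x s * t)) *
          ENNReal.ofReal ((∏ i, x i)⁻¹) ∂P := by
        simp only [lintegral_mul_const' _ _ ENNReal.ofReal_ne_top]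
    _ = ∫⁻ t, (∫⁻ x in B, phiVar1 φ (a j) (b j) (fun s => F (insertCoord j x s * t)) *
          ENNReal.ofReal ((∏ i, x i)⁻¹)) ∂P := by
        refine lintegral_lintegral_swap (AEMeasurable.mul (aemeasurable_phiVar1 hφ
          (g := fun (p : ({i : Fin N // i ≠ j} → ℝ) × (Fin N → ℝ)) s =>
            F (insertCoord j p.1 s * p.2)) (hF.comp ?_) _ _ _) (Measurable.aemeasurable ?_))
        · exact ((measurable_insertCoord j).comp
            ((measurable_fst.comp measurable_fst).prodMk measurable_snd)).mul
            (measurable_snd.comp measurable_fst)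
        · exact ((Finset.measurable_prod _ fun i _ =>
            (measurable_pi_apply i).comp measurable_fst).inv).ennreal_ofReal
    _ ≤ ∫⁻ t, secVar φ F (a * t) (b * t) j ∂P := by
        refine lintegral_mono_ae ?_
        filter_upwards [hP] with t ht
        exact lintegral_phiVar1_comp_mul_le_secVar φ F a b j ht

theorem IsBoxPartition.pos {N m : ℕ} {a b : Fin N → ℝ} {c d : Fin m → Fin N → ℝ}
    (h : IsBoxPartition a b c d) (ha : a ∈ RPos N) (k : Fin m) : c k ∈ RPos N := by
  have hk : c k ∈ ⋃ k, Set.pi univ fun i => Icc (c k i) (d k i) :=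
    mem_iUnion.2 ⟨k, fun i _ => ⟨le_rfl, h.1 k i⟩⟩
  rw [h.2.1] at hk
  exact fun i => (ha i).trans_le (hk i (mem_univ i)).1

theorem sum_boxPhi_le_totalVar {N m : ℕ} (φ : ℝ → ℝ) (F : (Fin N → ℝ) → ℝ) {a b : Fin N → ℝ}
    (ha : ∀ i, 0 < a i) (hab : ∀ i, a i ≤ b i) {c d : Fin m → Fin N → ℝ}
    (h : IsBoxPartition a b c d) : ∑ k, boxPhi φ F (c k) (d k) ≤ totalVar φ F := by
  refine le_trans ?_ (le_iSup₂_of_le a b (le_iSup₂_of_le ha hab le_rfl))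
  exact le_iSup₂_of_le m c (le_iSup₂_of_le d h le_rfl)

/-- If the increments of `g` are dominated by averages of the increments of the dilates of `F`,
then the `φ`-variation of `g` is at most that of `F`. -/
theorem totalVar_le_of_increments_le {N : ℕ} {φ : ℝ → ℝ} (hφ : Measurable fun x => φ |x|)
    {g F : (Fin N → ℝ) → ℝ} (hF : Measurable F) {P : Measure (Fin N → ℝ)}
    [IsProbabilityMeasure P] (hP : ∀ᵐ t ∂P, t ∈ RPos N)
    (h : ∀ s ∈ RPos N, ∀ s' ∈ RPos N, ENNReal.ofReal (φ |g s - g s'|) ≤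
      ∫⁻ t, ENNReal.ofReal (φ |F (s * t) - F (s' * t)|) ∂P) :
    totalVar φ g ≤ totalVar φ F := by
  refine iSup₂_le fun a b => iSup₂_le fun ha hab => iSup₂_le fun m c => iSup₂_le fun d hcd => ?_
  calc ∑ k, boxPhi φ g (c k) (d k)
      ≤ ∑ k, (∑ j, (∫⁻ t, secVar φ F (c k * t) (d k * t) j ∂P) ^ 2) ^ ((1 : ℝ) / 2) := by
        refine Finset.sum_le_sum fun k _ => ENNReal.rpow_le_rpow (Finset.sum_le_sum fun j _ => ?_)
          (by norm_num)
        exact pow_le_pow_left' (secVar_le_lintegral hφ hF hP h (hcd.pos ha k) j) 2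
    _ ≤ ∑ k, ∫⁻ t, boxPhi φ F (c k * t) (d k * t) ∂P :=
        Finset.sum_le_sum fun k _ => rpow_sum_lintegral_sq_le _ _ _
    _ ≤ ∫⁻ t, ∑ k, boxPhi φ F (c k * t) (d k * t) ∂P := sum_lintegral_le_lintegral_sum _ _ _
    _ ≤ ∫⁻ _, totalVar φ F ∂P := by
        refine lintegral_mono_ae ?_
        filter_upwards [hP] with t ht
        exact sum_boxPhi_le_totalVar φ F (fun i => mul_pos (ha i) (ht i))
          (fun i => mul_le_mul_of_nonneg_right (hab i) (ht i).le) (hcd.mul_right ht)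
    _ = totalVar φ F := by simp

theorem measurable_mellinOp {N : ℕ} {k f : (Fin N → ℝ) → ℝ} (hk : Measurable k)
    (hf : Measurable f) : Measurable (mellinOp k f) := by
  have hm : Measurable fun p : (Fin N → ℝ) × (Fin N → ℝ) =>
      k p.2 * f (p.1 * p.2) * (prodCoord p.2)⁻¹ :=
    ((hk.comp measurable_snd).mul (hf.comp (measurable_fst.mul measurable_snd))).mul
      (measurable_prodCoord.comp measurable_snd).inv
  exact (hm.stronglyMeasurable.integral_prod_right
    (ν := volume.restrict (RPos N))).measurable

theorem totalVar_mellinOp_le {N : ℕ} {φ : ℝ → ℝ} (hφ : IsPhiFun φ) {k f : (Fin N → ℝ) → ℝ}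
    {A : ℝ} (hA : 0 < A) (hk : Measurable k)
    (hint : IntegrableOn (fun t => k t * (prodCoord t)⁻¹) (RPos N))
    (hkA : ∫ t in RPos N, |k t| * (prodCoord t)⁻¹ ≤ A)
    (hk1 : ∫ t in RPos N, k t * (prodCoord t)⁻¹ = 1) (hf : Measurable f)
    (hdom : ∀ s ∈ RPos N, IntegrableOn (fun t => k t * f (s * t) * (prodCoord t)⁻¹) (RPos N))
    {l ζ : ℝ} (hl : 0 < l) (hlζ : l ≤ ζ / A) :
    totalVar φ (fun s => l * mellinOp k f s) ≤ totalVar φ (fun x => ζ * f x) := by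
  obtain ⟨P, hP, hPpos, σ, hσ, hrep⟩ := exists_isProbabilityMeasure_mellin hk hint hkA hk1
  have hlA : l * A ≤ ζ := (le_div_iff₀ hA).1 hlζ
  refine totalVar_le_of_increments_le hφ.continuous_comp_abs.measurable (hf.const_mul ζ) hPpos
    fun s hs s' hs' => ?_
  obtain ⟨hi, he⟩ := hrep _ (hdom s hs)
  obtain ⟨hi', he'⟩ := hrep _ (hdom s' hs')
  have heq : l * mellinOp k f s - l * mellinOp k f s' =
      ∫ t, l * (σ t * f (s * t) - σ t * f (s' * t)) ∂P := by
    rw [integral_const_mul, integral_sub hi hi', ← he, ← he', mul_sub]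
    rfl
  rw [heq]
  refine (ofReal_map_integral_le_lintegral hφ.convexOn_comp_abs
    (fun x => hφ.2.1 _ (abs_nonneg x)) ((hi.sub hi').const_mul l)).trans ?_
  refine lintegral_mono fun t => ENNReal.ofReal_le_ofReal
    (hφ.monotoneOn (mem_Ici.2 (abs_nonneg _)) (mem_Ici.2 (abs_nonneg _)) ?_)
  calc |l * (σ t * f (s * t) - σ t * f (s' * t))|
      = l * |σ t| * |f (s * t) - f (s' * t)| := by
        rw [← mul_sub, abs_mul, abs_mul, abs_of_pos hl, mul_assoc]
    _ ≤ ζ * |f (s * t) - f (s' * t)| := by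
        gcongr
        exact (mul_le_mul_of_nonneg_left (hσ t) hl.le).trans hlA
    _ = |ζ * f (s * t) - ζ * f (s' * t)| := by
        rw [← mul_sub, abs_mul, abs_of_nonneg ((mul_pos hl hA).le.trans hlA)]

/-- for `f ∈ BV^φ(ℝ^N_+)` with `V^φ[ζ f] < ∞`, and kernels satisfying
`(K_w.1)`, one has `V^φ[λ (T_w f)] ≤ V^φ[ζ f]` for every `0 < λ ≤ ζ/A` and `w > 0`;
in particular every `T_w` maps `BV^φ(ℝ^N_+)` into itself. -/
theorem statement0 {N : ℕ} (hN : 1 ≤ N) (φ : ℝ → ℝ) (hφ : IsPhiFun φ)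
    (K : ℝ → (Fin N → ℝ) → ℝ) (A : ℝ) (hA : 0 < A) (hK : KernelCond1 K A)
    (f : (Fin N → ℝ) → ℝ) (hf : Measurable f) (hdom : InDomain K f)
    (ζ : ℝ) (hζ : 0 < ζ) (hfin : totalVar φ (fun x => ζ * f x) < ⊤) :
    (∀ l : ℝ, 0 < l → l ≤ ζ / A → ∀ w > (0 : ℝ),
      totalVar φ (fun s => l * mellinOp (K w) f s) ≤ totalVar φ (fun x => ζ * f x)) ∧
    (∀ w > (0 : ℝ), MemBVphi φ (mellinOp (K w) f)) := by
  have key : ∀ l : ℝ, 0 < l → l ≤ ζ / A → ∀ w > (0 : ℝ),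
      totalVar φ (fun s => l * mellinOp (K w) f s) ≤ totalVar φ (fun x => ζ * f x) := by
    intro l hl hlζ w hw
    obtain ⟨hm, hint, hkA, hk1⟩ := hK w hw
    exact totalVar_mellinOp_le hφ hA hm hint hkA hk1 hf (hdom w hw) hl hlζ
  exact ⟨key, fun w hw => ⟨measurable_mellinOp (hK w hw).1 hf, ζ / A, div_pos hζ hA,
    (key _ (div_pos hζ hA) le_rfl w hw).trans_lt hfin⟩⟩

end
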